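/- arXiv:1303.0735 — 2 statements merged into one kernel-verified Lean document; each statement's English description precedes it below -/
import Mathlib

section
/- Let m_1,…,m_n be a minimal generating set of a monomial ideal I of R and let 1 ≤ i < j ≤ n. If there is no index k with k ≠ i, k ≠ j such that m_k strictly divides m_{ij}, then σ_{ij} ∉ 𝔪Z₂. -/
open MvPolynomial

noncomputable section

/-- The trivariate polynomial ring `K[x,y,z]`, with variables indexed by `Fin 3`. -/
abbrev PR (K : Type*) [Field K] : Type _ := MvPolynomial (Fin 3) K

/-- The monomial of `K[x,y,z]` with exponent vector `a : Fin 3 → ℕ`. -/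
noncomputable def monom (K : Type*) [Field K] (a : Fin 3 → ℕ) : PR K :=
  ∏ t, X t ^ a t

/-- `m 0, …, m (n-1)` (given by their exponent vectors) form a minimal generating set of the
monomial ideal they generate: they are pairwise distinct and no one divides another.
(Divisibility of monomials is pointwise `≤` of exponent vectors, so non-divisibility for all
pairs of distinct indices already implies distinctness.) -/
def MinGen {n : ℕ} (m : Fin n → Fin 3 → ℕ) : Prop :=
  ∀ i j, i ≠ j → ¬ m i ≤ m j

/-- Strict divisibility of monomials, in terms of exponent vectors: `a` divides `b` and `a ≠ b`. -/
def strictDvd (a b : Fin 3 → ℕ) : Prop := a ≤ b ∧ a ≠ b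

/-- Strong divisibility of monomials: `a` divides `b / x_t` for every variable `x_t`
dividing `b`. -/
def strongDvd (a b : Fin 3 → ℕ) : Prop :=
  ∀ t, 0 < b t → a ≤ b - Pi.single t 1

/-- A monomial ideal (given by the exponent vectors of its minimal generators) is generic if
whenever two distinct minimal generators have the same positive exponent in some variable,
a third minimal generator strongly divides their lcm. -/
def GenericI {n : ℕ} (m : Fin n → Fin 3 → ℕ) : Prop :=
  ∀ i j, i ≠ j → (∃ t, 0 < m i t ∧ m i t = m j t) →
    ∃ l, l ≠ i ∧ l ≠ j ∧ strongDvd (m l) (m i ⊔ m j)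

/-- The homogeneous maximal ideal `𝔪 = (x,y,z)` of `K[x,y,z]`. -/
noncomputable def mxIdeal (K : Type*) [Field K] : Ideal (PR K) :=
  Ideal.span (Set.range X)

/-- The `R`-linear map `f₁ : Rⁿ → R` sending the `i`-th standard basis vector to the
monomial `m_i`. -/
noncomputable def syzF1 (K : Type*) [Field K] {n : ℕ} (m : Fin n → Fin 3 → ℕ) :
    (Fin n → PR K) →ₗ[PR K] PR K where
  toFun v := ∑ i, v i * monom K (m i)
  map_add' u v := by simp [add_mul, Finset.sum_add_distrib]
  map_smul' c v := by simp [Finset.mul_sum, mul_assoc]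

/-- The module `Z₂ = ker f₁` of second syzygies of `R/I`. -/
noncomputable def Z2 (K : Type*) [Field K] {n : ℕ} (m : Fin n → Fin 3 → ℕ) :
    Submodule (PR K) (Fin n → PR K) :=
  LinearMap.ker (syzF1 K m)

/-- The S-pair `σ_{ij} = (m_{ij}/m_j)·e_j − (m_{ij}/m_i)·e_i ∈ Rⁿ`. -/
noncomputable def sigmaS (K : Type*) [Field K] {n : ℕ} (m : Fin n → Fin 3 → ℕ)
    (i j : Fin n) : Fin n → PR K :=
  Pi.single j (monom K ((m i ⊔ m j) - m j)) - Pi.single i (monom K ((m i ⊔ m j) - m i))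

/-- `τ_{ijl} = (m_{ijl}/m_{ij})·e_{ij} − (m_{ijl}/m_{il})·e_{il} + (m_{ijl}/m_{jl})·e_{jl}`,
an element of the free module `F₂` with basis `e_{pq}` indexed by pairs. -/
noncomputable def tauS (K : Type*) [Field K] {n : ℕ} (m : Fin n → Fin 3 → ℕ)
    (i j l : Fin n) : Fin n × Fin n → PR K :=
  Pi.single (i, j) (monom K ((m i ⊔ m j ⊔ m l) - (m i ⊔ m j)))
    - Pi.single (i, l) (monom K ((m i ⊔ m j ⊔ m l) - (m i ⊔ m l)))
    + Pi.single (j, l) (monom K ((m i ⊔ m j ⊔ m l) - (m j ⊔ m l)))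

/-- The submodule `Z₃` of `F₂` generated by all `τ_{abc}` with `a < b < c`. -/
noncomputable def Z3 (K : Type*) [Field K] {n : ℕ} (m : Fin n → Fin 3 → ℕ) :
    Submodule (PR K) (Fin n × Fin n → PR K) :=
  Submodule.span (PR K) {v | ∃ a b c : Fin n, a < b ∧ b < c ∧ v = tauS K m a b c}

theorem monom_eq_monomial (K : Type*) [Field K] (a : Fin 3 → ℕ) :
    monom K a = monomial (Finsupp.equivFunOnFinite.symm a) 1 := by
  rw [monomial_eq, C_1, one_mul, Finsupp.prod_fintype _ _ (fun _ => pow_zero _)]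
  rfl

/-- If `m_j` is the only generator dividing the monomial `b`, then for every syzygy `z` the
monomial `b / m_j` does not occur in `z_j`. -/
theorem coeff_eq_zero_of_mem_Z2 {K : Type*} [Field K] {n : ℕ} {m : Fin n → Fin 3 → ℕ}
    {z : Fin n → PR K} (hz : z ∈ Z2 K m) {j : Fin n} {b : Fin 3 →₀ ℕ}
    (hj : m j ≤ b) (hb : ∀ l, l ≠ j → ¬ m l ≤ b) :
    coeff (b - Finsupp.equivFunOnFinite.symm (m j)) (z j) = 0 := by
  have hz' : ∑ l, z l * monom K (m l) = 0 := hz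
  have hc := congrArg (coeff b) hz'
  rw [coeff_sum, Finset.sum_eq_single j, monom_eq_monomial, coeff_mul_monomial',
    if_pos (show Finsupp.equivFunOnFinite.symm (m j) ≤ b from hj)] at hc
  · simpa using hc
  · intro l _ hl
    rw [monom_eq_monomial, coeff_mul_monomial',
      if_neg (show ¬ Finsupp.equivFunOnFinite.symm (m l) ≤ b from hb l hl)]
  · simp

/-- If `m_j` divides `b` and is the only generator dividing `b / x_t` whenever `x_t` divides
`b / m_j`, then the monomial `b / m_j` does not occur in the `j`-th component of any element
of `𝔪Z₂`. -/
theorem coeff_eq_zero_of_mem_mxIdeal_smul_Z2 {K : Type*} [Field K] {n : ℕ}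
    {m : Fin n → Fin 3 → ℕ} {v : Fin n → PR K} (hv : v ∈ mxIdeal K • Z2 K m)
    {j : Fin n} {b : Fin 3 → ℕ} (hj : m j ≤ b)
    (hb : ∀ t, m j t < b t → ∀ l, l ≠ j → ¬ m l ≤ b - Pi.single t 1) :
    coeff (Finsupp.equivFunOnFinite.symm (b - m j)) (v j) = 0 := by
  induction hv using Submodule.smul_induction_on' with
  | add x _ y _ hx hy => rw [Pi.add_apply, coeff_add, hx, hy, add_zero]
  | smul r hr z hz =>
    induction hr using Submodule.span_induction generalizing z with
    | zero => simp
    | add x y _ _ hx hy => rw [add_smul, Pi.add_apply, coeff_add, hx z hz, hy z hz, add_zero]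
    | smul a x _ hx =>
      rw [smul_assoc, smul_comm]
      exact hx _ (Submodule.smul_mem _ a hz)
    | mem x hx =>
      obtain ⟨t, rfl⟩ := hx
      rw [Pi.smul_apply, smul_eq_mul, coeff_X_mul']
      split_ifs with ht
      · have hlt : m j t < b t := by
          have : b t - m j t ≠ 0 := by simpa using ht
          omega
        have hcoe : ⇑(Finsupp.equivFunOnFinite.symm (b - Pi.single t 1)) = b - Pi.single t 1 :=
          rfl
        have key := coeff_eq_zero_of_mem_Z2 hz (j := j)
          (b := Finsupp.equivFunOnFinite.symm (b - Pi.single t 1)) ?_ ?_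
        · convert key using 2
          ext s
          simp only [Finsupp.coe_tsub, Pi.sub_apply, Finsupp.equivFunOnFinite_symm_apply_apply,
            Finsupp.single_apply, Pi.single_apply, eq_comm (a := t)]
          omega
        · rw [hcoe]
          intro s
          have := hj s
          by_cases hs : s = t
          · subst hs
            simp only [Pi.sub_apply, Pi.single_eq_same]
            omega
          · simpa [hs] using this
        · rw [hcoe]
          exact hb t hlt
      · rfl

/-- If no minimal generator `m_l` (with `l ≠ i, j`) strictly divides
`m_{ij}`, then `σ_{ij} ∉ 𝔪Z₂`. -/
theorem stmt5 (K : Type*) [Field K] {n : ℕ} (m : Fin n → Fin 3 → ℕ) (hm : MinGen m)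
    (i j : Fin n) (hij : i < j)
    (h : ¬ ∃ l, l ≠ i ∧ l ≠ j ∧ strictDvd (m l) (m i ⊔ m j)) :
    sigmaS K m i j ∉ mxIdeal K • Z2 K m := by
  intro hmem
  have hzero := coeff_eq_zero_of_mem_mxIdeal_smul_Z2 hmem (j := j) (b := m i ⊔ m j) le_sup_right ?_
  · simp [sigmaS, hij.ne', monom_eq_monomial] at hzero
  intro t ht l hl hle
  have hle' : m l ≤ m i ⊔ m j := hle.trans tsub_le_self
  by_cases hli : l = i
  · subst hli
    have h1 := hle t
    simp only [Pi.sub_apply, Pi.sup_apply, Pi.single_eq_same] at h1 ht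
    omega
  · refine h ⟨l, hli, hl, hle', fun heq => hm i l (Ne.symm hli) ?_⟩
    rw [heq]
    exact le_sup_left
end
end

section
/- Let m_1,…,m_n (n ≥ 4) be a minimal generating set of an 𝔪-primary monomial ideal I of R. Then the set of pairs (i,j) with 1 ≤ i < j ≤ n such that gcd(m_i,m_j) = 1 and σ_{ij} ∉ 𝔪Z₂ has cardinality at most n − 1. (Since each such S-pair σ_{ij} = m_i·e_j − m_j·e_i contributes exactly the two entries m_i, m_j lying in I, this is the paper's bound of at most 2n − 2 nonzero entries from I in the matrix f₂.) -/
open MvPolynomial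

noncomputable section

lemma monom_add (K : Type*) [Field K] (a b : Fin 3 → ℕ) :
    monom K (a + b) = monom K a * monom K b := by
  simp [monom, pow_add, Finset.prod_mul_distrib]

lemma monom_mem_mxIdeal (K : Type*) [Field K] {a : Fin 3 → ℕ} (ha : a ≠ 0) :
    monom K a ∈ mxIdeal K := by
  obtain ⟨t, ht⟩ := Function.ne_iff.mp ha
  have hX : (X t : PR K) ∈ mxIdeal K := Ideal.subset_span ⟨t, rfl⟩
  exact Ideal.mem_of_dvd _ (Finset.dvd_prod_of_mem _ (Finset.mem_univ t))
    (Ideal.pow_mem_of_mem _ hX _ (Nat.pos_of_ne_zero ht))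

lemma sigmaS_mem_Z2 (K : Type*) [Field K] {n : ℕ} (m : Fin n → Fin 3 → ℕ) (i j : Fin n) :
    sigmaS K m i j ∈ Z2 K m := by
  change ∑ l, sigmaS K m i j l * monom K (m l) = 0
  simp only [sigmaS, Pi.sub_apply, sub_mul, Finset.sum_sub_distrib, Pi.single_apply, ite_mul,
    zero_mul, Finset.sum_ite_eq', Finset.mem_univ, if_true, ← monom_add]
  rw [tsub_add_cancel_of_le le_sup_right, tsub_add_cancel_of_le le_sup_left, sub_self]

/-- The S-pair `σ_{ij}` is a combination of `σ_{il}` and `σ_{lj}` when `m_l` divides `m_{ij}`. -/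
lemma sigmaS_eq_add (K : Type*) [Field K] {n : ℕ} (m : Fin n → Fin 3 → ℕ) {i j l : Fin n}
    (hl : m l ≤ m i ⊔ m j) :
    sigmaS K m i j =
      monom K ((m i ⊔ m j) - (m i ⊔ m l)) • sigmaS K m i l +
        monom K ((m i ⊔ m j) - (m l ⊔ m j)) • sigmaS K m l j := by
  have hil : m i ⊔ m l ≤ m i ⊔ m j := sup_le le_sup_left hl
  have hlj : m l ⊔ m j ≤ m i ⊔ m j := sup_le hl le_sup_right
  simp only [sigmaS, smul_sub, ← Pi.single_smul, smul_eq_mul, ← monom_add]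
  rw [tsub_add_tsub_cancel hil le_sup_right, tsub_add_tsub_cancel hil le_sup_left,
    tsub_add_tsub_cancel hlj le_sup_right, tsub_add_tsub_cancel hlj le_sup_left]
  abel

lemma le_of_sup_eq_sup_of_inf_eq_zero {a b c : Fin 3 → ℕ} (h0 : a ⊓ b = 0)
    (h : a ⊔ c = a ⊔ b) : b ≤ c := by
  intro t
  have h1 : min (a t) (b t) = 0 := congrFun h0 t
  have h2 : max (a t) (c t) = max (a t) (b t) := congrFun h t
  rcases Nat.min_eq_zero_iff.mp h1 with h3 | h3 <;> simp_all

/-- For coprime generators, the S-pair `σ_{ij}` is not minimal as soon as a third generator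
divides `m_{ij}`. -/
lemma sigmaS_mem_of_le (K : Type*) [Field K] {n : ℕ} {m : Fin n → Fin 3 → ℕ} (hm : MinGen m)
    {i j l : Fin n} (h0 : m i ⊓ m j = 0) (hli : l ≠ i) (hlj : l ≠ j) (hl : m l ≤ m i ⊔ m j) :
    sigmaS K m i j ∈ mxIdeal K • Z2 K m := by
  rw [sigmaS_eq_add K m hl]
  refine add_mem (Submodule.smul_mem_smul (monom_mem_mxIdeal K fun h => ?_) (sigmaS_mem_Z2 K m i l))
    (Submodule.smul_mem_smul (monom_mem_mxIdeal K fun h => ?_) (sigmaS_mem_Z2 K m l j))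
  · exact hm j l hlj.symm (le_of_sup_eq_sup_of_inf_eq_zero h0
      (le_antisymm (sup_le le_sup_left hl) (tsub_eq_zero_iff_le.mp h)))
  · refine hm i l hli.symm (le_of_sup_eq_sup_of_inf_eq_zero (inf_comm (m i) (m j) ▸ h0) ?_)
    rw [sup_comm (m j), sup_comm (m j)]
    exact le_antisymm (sup_le hl le_sup_right) (tsub_eq_zero_iff_le.mp h)

/-- The pair `(i, j)` in increasing order. -/
def sortedPair {n : ℕ} (i j : Fin n) : Fin n × Fin n := (i ⊓ j, i ⊔ j)

lemma sortedPair_comm {n : ℕ} (i j : Fin n) : sortedPair i j = sortedPair j i := by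
  simp [sortedPair, inf_comm, sup_comm]

lemma sortedPair_of_lt {n : ℕ} {i j : Fin n} (h : i < j) : sortedPair i j = (i, j) := by
  simp [sortedPair, h.le]

/-- A generator other than the pure power `x_t ^ a` has exponent less than `a` at `x_t`. -/
lemma MinGen.lt_purePower {n : ℕ} {m : Fin n → Fin 3 → ℕ} (hm : MinGen m) {l q : Fin n}
    {t : Fin 3} (hq : ∀ s, s ≠ t → m q s = 0) (hl : l ≠ q) : m l t < m q t := by
  by_contra! h
  refine hm q l hl.symm fun s => ?_
  by_cases hs : s = t
  · exact hs ▸ h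
  · simp [hq s hs]

/-- A generator which is not a pure power has at most one vanishing exponent. -/
lemma MinGen.eq_of_apply_eq_zero {n : ℕ} {m : Fin n → Fin 3 → ℕ} (hm : MinGen m)
    {P : Fin 3 → Fin n} (hP : ∀ t, 0 < m (P t) t ∧ ∀ s, s ≠ t → m (P t) s = 0) {l : Fin n}
    (hl : ∀ t, l ≠ P t) {u v : Fin 3} (hu : m l u = 0) (hv : m l v = 0) : u = v := by
  by_contra huv
  obtain ⟨t, ht⟩ : ∃ t : Fin 3, ∀ s, s ≠ t → s = u ∨ s = v := by
    clear hu hv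
    decide +revert
  refine hm l (P t) (hl t) fun s => ?_
  by_cases hs : s = t
  · exact hs ▸ (hm.lt_purePower (hP t).2 (hl t)).le
  · rcases ht s hs with rfl | rfl <;> simp [*]

/-- For an `𝔪`-primary monomial ideal minimally generated by `n ≥ 4` monomials,
the set of pairs `i < j` with `gcd(m_i,m_j) = 1` and `σ_{ij} ∉ 𝔪Z₂` has at most `n - 1`
elements (equivalently, `f₂` has at most `2n − 2` nonzero entries from `I`). -/
theorem stmt7 (K : Type*) [Field K] {n : ℕ} (hn : 4 ≤ n)
    (m : Fin n → Fin 3 → ℕ) (hm : MinGen m)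
    (hprim : ∀ t : Fin 3, ∃ i, 0 < m i t ∧ ∀ s, s ≠ t → m i s = 0) :
    {p : Fin n × Fin n | p.1 < p.2 ∧ m p.1 ⊓ m p.2 = 0 ∧
      sigmaS K m p.1 p.2 ∉ mxIdeal K • Z2 K m}.ncard ≤ n - 1 := by
  classical
  choose P hP using hprim
  have hPinj : Function.Injective P := by
    intro s t hst
    by_contra h
    have h1 := (hP s).1
    rw [hst, (hP t).2 s h] at h1
    exact h1.false
  -- `g` covers all the pairs in question: a pure power indexes the pair of the other two,
  -- any other generator is paired with the pure power of a variable not dividing it.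
  let g : Fin n → Fin n × Fin n := fun l =>
    if h : ∃ u, l = P u then sortedPair (P (h.choose + 1)) (P (h.choose + 2))
    else if h : ∃ u, m l u = 0 then sortedPair l (P h.choose) else (l, l)
  have g_pure (u : Fin 3) : g (P u) = sortedPair (P (u + 1)) (P (u + 2)) := by
    have h : ∃ v, P u = P v := ⟨u, rfl⟩
    simp only [g, dif_pos h, ← hPinj h.choose_spec]
  have g_mixed (l : Fin n) (hl : ∀ t, l ≠ P t) (u : Fin 3) (hu : m l u = 0) :
      g l = sortedPair l (P u) := by
    have h : ∃ v, m l v = 0 := ⟨u, hu⟩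
    simp only [g, dif_neg (not_exists.mpr hl), dif_pos h,
      hm.eq_of_apply_eq_zero hP hl h.choose_spec hu]
  obtain ⟨l₁, hl₁⟩ : ∃ l, ∀ t, l ≠ P t := by
    by_contra! h
    have := Fintype.card_le_of_surjective P fun l => (h l).imp fun _ => Eq.symm
    simp only [Fintype.card_fin] at this
    omega
  obtain ⟨l₀, h_pure, h_mixed⟩ : ∃ l₀, (∀ u, P u = l₀ → m l₁ u = 0) ∧
      (∀ l, (∀ t, l ≠ P t) → l = l₀ → ∀ u, m l u ≠ 0) := by
    by_cases h : ∃ u, m l₁ u = 0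
    · obtain ⟨u, hu⟩ := h
      exact ⟨P u, fun v hv => hPinj hv ▸ hu, fun l hl h => absurd h (hl u)⟩
    · exact ⟨l₁, fun u hu => absurd hu.symm (hl₁ u), fun l _ hl => hl ▸ not_exists.mp h⟩
  have covers_mixed (i j : Fin n) (hi : ∀ t, i ≠ P t) (h0 : m i ⊓ m j = 0) :
      ∃ l, l ≠ l₀ ∧ g l = sortedPair i j := by
    have hmin (t : Fin 3) : m i t = 0 ∨ m j t = 0 := by
      have : min (m i t) (m j t) = 0 := congrFun h0 t
      omega
    obtain ⟨u, rfl⟩ : ∃ u, j = P u := by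
      by_contra! hj
      have e (a b : Fin 3) (hab : a ≠ b) : ¬ (m i a = 0 ∧ m i b = 0) := fun h =>
        hab (hm.eq_of_apply_eq_zero hP hi h.1 h.2)
      have f (a b : Fin 3) (hab : a ≠ b) : ¬ (m j a = 0 ∧ m j b = 0) := fun h =>
        hab (hm.eq_of_apply_eq_zero hP hj h.1 h.2)
      have := hmin 0
      have := hmin 1
      have := hmin 2
      have := e 0 1 (by decide)
      have := e 0 2 (by decide)
      have := e 1 2 (by decide)
      have := f 0 1 (by decide)
      have := f 0 2 (by decide)
      have := f 1 2 (by decide)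
      tauto
    have hu : m i u = 0 := (hmin u).resolve_right (hP u).1.ne'
    exact ⟨i, fun h => h_mixed i hi h u hu, g_mixed i hi u hu⟩
  have hsub : {p : Fin n × Fin n | p.1 < p.2 ∧ m p.1 ⊓ m p.2 = 0 ∧
      sigmaS K m p.1 p.2 ∉ mxIdeal K • Z2 K m} ⊆ ((Finset.univ.erase l₀).image g : Finset _) := by
    rintro ⟨i, j⟩ ⟨hij, h0, hσ⟩
    simp only at hij h0 hσ
    simp only [Finset.coe_image, Finset.coe_erase, Finset.coe_univ, Set.mem_image, Set.mem_sdiff,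
      Set.mem_univ, true_and, Set.mem_singleton_iff]
    rw [← sortedPair_of_lt hij]
    by_cases hi : ∀ t, i ≠ P t
    · exact covers_mixed i j hi h0
    by_cases hj : ∀ t, j ≠ P t
    · rw [sortedPair_comm]
      exact covers_mixed j i hj (inf_comm (m i) (m j) ▸ h0)
    push Not at hi hj
    obtain ⟨s, rfl⟩ := hi
    obtain ⟨t, rfl⟩ := hj
    have hst : s ≠ t := fun h => hij.ne (congrArg P h)
    obtain ⟨u, hu, hcov⟩ : ∃ u : Fin 3, (s = u + 1 ∧ t = u + 2 ∨ t = u + 1 ∧ s = u + 2) ∧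
        ∀ v, v = u ∨ v = s ∨ v = t := by
      clear * - hst
      decide +revert
    refine ⟨P u, fun h => hσ (sigmaS_mem_of_le K hm h0 (hl₁ s) (hl₁ t) fun v => ?_), ?_⟩
    · rcases hcov v with rfl | rfl | rfl
      · simp [h_pure _ h]
      · exact le_sup_of_le_left (hm.lt_purePower (hP _).2 (hl₁ _)).le
      · exact le_sup_of_le_right (hm.lt_purePower (hP _).2 (hl₁ _)).le
    · rcases hu with ⟨rfl, rfl⟩ | ⟨rfl, rfl⟩
      · exact g_pure u
      · rw [g_pure u, sortedPair_comm]
  calc _ ≤ ((Finset.univ.erase l₀).image g).card := by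
        rw [← Set.ncard_coe_finset]
        exact Set.ncard_le_ncard hsub (Finset.finite_toSet _)
    _ ≤ (Finset.univ.erase l₀).card := Finset.card_image_le
    _ = n - 1 := by simp [Finset.card_erase_of_mem]
end
end
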